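/- arXiv:2303.02532 — 8 statements merged into one kernel-verified Lean document; each statement's English description precedes it below -/
import Mathlib

section
/- For all x, x′ ∈ ℝ^{p1} one has ‖y*(x) − y*(x′)‖ ≤ (L_f/μ)·‖x − x′‖; that is, the maximizer map x ↦ argmax_{y∈Y} F(x,y) is Lipschitz continuous with constant L_y = L_f/μ. -/
open scoped RealInnerProductSpace

/-- Lipschitz continuity of the maximizer map `x ↦ y*(x)` with constant `L_f/μ`. -/
theorem stmt_0
    (p1 p2 : ℕ)
    (F : EuclideanSpace ℝ (Fin p1) → EuclideanSpace ℝ (Fin p2) → ℝ)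
    (Lf μ : ℝ) (hLf : 0 < Lf) (hμ : 0 < μ)
    (Y : Set (EuclideanSpace ℝ (Fin p2)))
    (hYne : Y.Nonempty) (hYclosed : IsClosed Y) (hYconvex : Convex ℝ Y)
    (hdiffx : ∀ y, Differentiable ℝ (fun x => F x y))
    (hdiffy : ∀ x, Differentiable ℝ (fun y => F x y))
    -- `L_f`-Lipschitz continuity of the (joint) gradient of `F`
    (hlip : ∀ x x' y y',
      ‖gradient (fun u => F u y) x - gradient (fun u => F u y') x'‖ ^ 2
        + ‖gradient (fun v => F x v) y - gradient (fun v => F x' v) y'‖ ^ 2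
      ≤ Lf ^ 2 * (‖x - x'‖ ^ 2 + ‖y - y'‖ ^ 2))
    -- `μ`-strong concavity of `y ↦ F x y` for every fixed `x`
    (hconc : ∀ x y y', F x y' ≤ F x y + ⟪gradient (fun v => F x v) y, y' - y⟫
      - μ / 2 * ‖y' - y‖ ^ 2)
    -- `y*(x)` is the unique maximizer of `F x ·` over `Y`
    (ystar : EuclideanSpace ℝ (Fin p1) → EuclideanSpace ℝ (Fin p2))
    (hystar_mem : ∀ x, ystar x ∈ Y)
    (hystar_max : ∀ x, IsMaxOn (fun y => F x y) Y (ystar x))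
    (hystar_uniq : ∀ x y, y ∈ Y → IsMaxOn (fun y' => F x y') Y y → y = ystar x) :
    ∀ x x', ‖ystar x - ystar x'‖ ≤ (Lf / μ) * ‖x - x'‖ := by
  have foc : ∀ x, ∀ z ∈ Y, ⟪gradient (fun v => F x v) (ystar x), z - ystar x⟫ ≤ 0 := by
    intro x z hz
    have h1 : HasGradientAt (fun v => F x v) (gradient (fun v => F x v) (ystar x)) (ystar x) :=
      ((hdiffy x) (ystar x)).hasGradientAt
    have h2 := (hystar_max x).localize.hasFDerivWithinAt_nonpos
      h1.hasFDerivAt.hasFDerivWithinAt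
      (sub_mem_posTangentConeAt_of_segment_subset (hYconvex.segment_subset (hystar_mem x) hz))
    simpa using h2
  intro x x'
  have h1 := foc x _ (hystar_mem x')
  have h2 := foc x' _ (hystar_mem x)
  have c1 := hconc x (ystar x) (ystar x')
  have c2 := hconc x (ystar x') (ystar x)
  have hl := hlip x x' (ystar x') (ystar x')
  generalize ystar x = a at *
  generalize ystar x' = b at *
  have hg : ‖gradient (fun v => F x v) b - gradient (fun v => F x' v) b‖ ≤ Lf * ‖x - x'‖ := by
    refine (sq_le_sq₀ (norm_nonneg _) (by positivity)).1 ?_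
    rw [mul_pow]
    simp only [sub_self, norm_zero] at hl
    nlinarith [sq_nonneg ‖gradient (fun u => F u b) x - gradient (fun u => F u b) x'‖]
  have cs := real_inner_le_norm
    (gradient (fun v => F x v) b - gradient (fun v => F x' v) b) (a - b)
  rw [inner_sub_left] at cs
  rw [norm_sub_rev b a] at c1
  have hm := mul_le_mul_of_nonneg_right hg (norm_nonneg (a - b))
  have key : μ * ‖a - b‖ ^ 2 ≤ Lf * ‖x - x'‖ * ‖a - b‖ := by
    linarith
  rw [div_mul_eq_mul_div, le_div_iff₀ hμ]
  rcases (norm_nonneg (a - b)).eq_or_lt with h | h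
  · rw [← h]; simp; positivity
  · refine le_of_mul_le_mul_right ?_ h
    linarith [key]
end

section
/- The function J(x) = max_{y∈Y} F(x,y) is differentiable on ℝ^{p1}, and its gradient is given by Danskin's formula ∇J(x) = ∇_x F(x, y*(x)) for every x ∈ ℝ^{p1}. -/
open scoped RealInnerProductSpace

/-- Danskin's formula: `J(x) = max_{y ∈ Y} F(x,y)` is differentiable with
`∇J(x) = ∇_x F(x, y*(x))`. -/
theorem stmt_1
    (p1 p2 : ℕ)
    (F : EuclideanSpace ℝ (Fin p1) → EuclideanSpace ℝ (Fin p2) → ℝ)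
    (Lf μ : ℝ) (hLf : 0 < Lf) (hμ : 0 < μ)
    (Y : Set (EuclideanSpace ℝ (Fin p2)))
    (hYne : Y.Nonempty) (hYclosed : IsClosed Y) (hYconvex : Convex ℝ Y)
    (hdiffx : ∀ y, Differentiable ℝ (fun x => F x y))
    (hdiffy : ∀ x, Differentiable ℝ (fun y => F x y))
    -- `L_f`-Lipschitz continuity of the (joint) gradient of `F`
    (hlip : ∀ x x' y y',
      ‖gradient (fun u => F u y) x - gradient (fun u => F u y') x'‖ ^ 2
        + ‖gradient (fun v => F x v) y - gradient (fun v => F x' v) y'‖ ^ 2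
      ≤ Lf ^ 2 * (‖x - x'‖ ^ 2 + ‖y - y'‖ ^ 2))
    -- `μ`-strong concavity of `y ↦ F x y` for every fixed `x`
    (hconc : ∀ x y y', F x y' ≤ F x y + ⟪gradient (fun v => F x v) y, y' - y⟫
      - μ / 2 * ‖y' - y‖ ^ 2)
    -- `y*(x)` is the unique maximizer of `F x ·` over `Y`
    (ystar : EuclideanSpace ℝ (Fin p1) → EuclideanSpace ℝ (Fin p2))
    (hystar_mem : ∀ x, ystar x ∈ Y)
    (hystar_max : ∀ x, IsMaxOn (fun y => F x y) Y (ystar x))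
    (hystar_uniq : ∀ x y, y ∈ Y → IsMaxOn (fun y' => F x y') Y y → y = ystar x)
    -- `J(x) = max_{y ∈ Y} F(x, y)`, i.e. `J x` is the greatest value of `F x ·` on `Y`
    (J : EuclideanSpace ℝ (Fin p1) → ℝ)
    (hJ : ∀ x, IsGreatest ((fun y => F x y) '' Y) (J x)) :
    ∀ x, HasGradientAt J (gradient (fun u => F u (ystar x)) x) x := by
  have hgx : ∀ x y, HasGradientAt (fun u => F u y) (gradient (fun u => F u y) x) x :=
    fun x y => (hdiffx y x).hasGradientAt
  have hgy : ∀ x y, HasGradientAt (fun v => F x v) (gradient (fun v => F x v) y) y :=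
    fun x y => (hdiffy x y).hasGradientAt
  have hJeq : ∀ x, J x = F x (ystar x) := by
    intro x
    obtain ⟨⟨y, hy, hy2⟩, hub⟩ := hJ x
    apply le_antisymm
    · rw [← hy2]; exact hystar_max x hy
    · exact hub ⟨ystar x, hystar_mem x, rfl⟩
  -- first-order optimality
  have hopt : ∀ x y, y ∈ Y → ⟪gradient (fun v => F x v) (ystar x), y - ystar x⟫ ≤ 0 := by
    intro x y hy
    have h1 : IsLocalMaxOn (fun y => F x y) Y (ystar x) := (hystar_max x).localize
    have h2 := h1.hasFDerivWithinAt_nonpos (hgy x (ystar x)).hasFDerivAt.hasFDerivWithinAt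
      (sub_mem_posTangentConeAt_of_segment_subset (hYconvex.segment_subset (hystar_mem x) hy))
    simpa using h2
  -- Lipschitz bounds
  have hlx : ∀ x x' y y', ‖gradient (fun u => F u y) x - gradient (fun u => F u y') x'‖
      ≤ Lf * (‖x - x'‖ + ‖y - y'‖) := by
    intro x x' y y'
    refine le_of_sq_le_sq ?_ (by positivity)
    have := hlip x x' y y'
    have h3 : 0 ≤ Lf ^ 2 * (‖x - x'‖ * ‖y - y'‖) := by positivity
    nlinarith [sq_nonneg ‖gradient (fun v => F x v) y - gradient (fun v => F x' v) y'‖]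
  have hly : ∀ x x' y, ‖gradient (fun v => F x v) y - gradient (fun v => F x' v) y‖
      ≤ Lf * ‖x - x'‖ := by
    intro x x' y
    refine le_of_sq_le_sq ?_ (by positivity)
    have := hlip x x' y y
    simp only [sub_self, norm_zero] at this
    nlinarith [sq_nonneg ‖gradient (fun u => F u y) x - gradient (fun u => F u y) x'‖]
  have hys : ∀ x x', ‖ystar x' - ystar x‖ ≤ Lf / μ * ‖x' - x‖ := by
    intro x x'
    have a1 := hopt x (ystar x') (hystar_mem x')
    have a2 := hopt x' (ystar x) (hystar_mem x)
    have a3 := hconc x (ystar x') (ystar x)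
    have a4 := hconc x (ystar x) (ystar x')
    have a5 := real_inner_le_norm (gradient (fun v => F x v) (ystar x')
      - gradient (fun v => F x' v) (ystar x')) (ystar x - ystar x')
    rw [inner_sub_left] at a5
    have a6 := mul_le_mul_of_nonneg_right (hly x x' (ystar x'))
      (norm_nonneg (ystar x - ystar x'))
    rw [norm_sub_rev (ystar x) (ystar x')] at a3 a5 a6
    rw [norm_sub_rev x x'] at a6
    rw [div_mul_eq_mul_div, le_div_iff₀ hμ]
    rcases (norm_nonneg (ystar x' - ystar x)).eq_or_lt with h0 | h0
    · rw [← h0]; simp; positivity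
    · apply le_of_mul_le_mul_right _ h0
      nlinarith
  have hmv : ∀ x x' y y0, |F x' y - F x y - ⟪gradient (fun u => F u y0) x, x' - x⟫|
      ≤ Lf * (‖x' - x‖ + ‖y - y0‖) * ‖x' - x‖ := by
    intro x x' y y0
    have h := (convex_closedBall x ‖x' - x‖).norm_image_sub_le_of_norm_hasFDerivWithin_le'
      (f := fun u => F u y)
      (φ := InnerProductSpace.toDual ℝ _ (gradient (fun u => F u y0) x))
      (C := Lf * (‖x' - x‖ + ‖y - y0‖)) (x := x) (y := x')
      (fun z _ => (hgx z y).hasFDerivAt.hasFDerivWithinAt)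
      (fun z hz => by
        rw [← map_sub, LinearIsometryEquiv.norm_map]
        refine (hlx z x y y0).trans ?_
        rw [mem_closedBall_iff_norm] at hz
        gcongr)
      (by simp) (by simp [dist_eq_norm])
    simpa using h
  intro x
  rw [hasGradientAt_iff_isLittleO]
  have hO : (fun x' => J x' - J x - ⟪gradient (fun u => F u (ystar x)) x, x' - x⟫)
      =O[nhds x] (fun x' => ‖x' - x‖ ^ 2) := by
    apply Asymptotics.IsBigO.of_bound (Lf * (1 + Lf / μ))
    filter_upwards with x'
    rw [Real.norm_eq_abs, norm_pow, norm_norm, hJeq, hJeq]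
    have b1 := abs_le.1 (hmv x x' (ystar x) (ystar x))
    have b2 := abs_le.1 (hmv x x' (ystar x') (ystar x))
    have b3 : F x (ystar x') ≤ F x (ystar x) := hystar_max x (hystar_mem x')
    have b4 : F x' (ystar x) ≤ F x' (ystar x') := hystar_max x' (hystar_mem x)
    have b5 : Lf * (‖x' - x‖ + ‖ystar x' - ystar x‖) * ‖x' - x‖
        ≤ Lf * (‖x' - x‖ + Lf / μ * ‖x' - x‖) * ‖x' - x‖ := by
      gcongr; exact hys x x'
    have b6 : Lf * (‖x' - x‖ + Lf / μ * ‖x' - x‖) * ‖x' - x‖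
        = Lf * (1 + Lf / μ) * ‖x' - x‖ ^ 2 := by ring
    have b7 : Lf * (‖x' - x‖ + ‖ystar x - ystar x‖) * ‖x' - x‖
        ≤ Lf * (‖x' - x‖ + Lf / μ * ‖x' - x‖) * ‖x' - x‖ := by
      gcongr; rw [sub_self, norm_zero]; positivity
    rw [abs_le]
    constructor <;> linarith [b1.1, b1.2, b2.1, b2.2]
  refine hO.trans_isLittleO ?_
  exact Asymptotics.isLittleO_pow_sub_sub x (by norm_num : 1 < 2)
end

section
/- Let y ∈ Y, d ∈ ℝ^p, and 0 < α ≤ 1/(2L), and let ỹ be the metric projection of y + α·d onto Y (the unique point of Y closest to y + αd). Then (μ/2)‖y* − y‖² + (1/(2α))‖ỹ − y‖² ≤ (1/α)⟨ỹ − y, y* − y⟩ + (2/μ)‖∇g(y) − d‖² + (μ/4)‖y* − y‖² + (μ/4)‖ỹ − y‖². -/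
open scoped RealInnerProductSpace

/-- Key inequality for the projected ascent step: with `ỹ` the metric projection of
`y + α d` onto `Y` and `0 < α ≤ 1/(2L)`,
`(μ/2)‖y* − y‖² + (1/(2α))‖ỹ − y‖² ≤ (1/α)⟨ỹ − y, y* − y⟩ + (2/μ)‖∇g(y) − d‖²
  + (μ/4)‖y* − y‖² + (μ/4)‖ỹ − y‖²`. -/
theorem stmt_4
    (p : ℕ)
    (g : EuclideanSpace ℝ (Fin p) → ℝ)
    (μ L : ℝ) (hμ : 0 < μ) (hL : 0 < L)
    (hdiff : Differentiable ℝ g)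
    -- `μ`-strong concavity of `g`
    (hconc : ∀ y y', g y' ≤ g y + ⟪gradient g y, y' - y⟫ - μ / 2 * ‖y' - y‖ ^ 2)
    -- `L`-Lipschitz continuity of `∇g`
    (hlip : ∀ y y', ‖gradient g y - gradient g y'‖ ≤ L * ‖y - y'‖)
    (Y : Set (EuclideanSpace ℝ (Fin p)))
    (hYne : Y.Nonempty) (hYclosed : IsClosed Y) (hYconvex : Convex ℝ Y)
    -- `y*` is the unique maximizer of `g` over `Y`
    (ystar : EuclideanSpace ℝ (Fin p))
    (hystar_mem : ystar ∈ Y)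
    (hystar_max : IsMaxOn g Y ystar)
    (hystar_uniq : ∀ y ∈ Y, IsMaxOn g Y y → y = ystar)
    (y : EuclideanSpace ℝ (Fin p)) (hy : y ∈ Y)
    (d : EuclideanSpace ℝ (Fin p))
    (α : ℝ) (hα : 0 < α) (hαL : α ≤ 1 / (2 * L))
    -- `ỹ` is the metric projection of `y + α • d` onto `Y`
    (yt : EuclideanSpace ℝ (Fin p)) (hyt_mem : yt ∈ Y)
    (hyt_proj : ∀ z ∈ Y, ‖y + α • d - yt‖ ≤ ‖y + α • d - z‖) :
    μ / 2 * ‖ystar - y‖ ^ 2 + 1 / (2 * α) * ‖yt - y‖ ^ 2 ≤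
      1 / α * ⟪yt - y, ystar - y⟫ + 2 / μ * ‖gradient g y - d‖ ^ 2
        + μ / 4 * ‖ystar - y‖ ^ 2 + μ / 4 * ‖yt - y‖ ^ 2 := by
  have hproj : ⟪y + α • d - yt, ystar - yt⟫ ≤ 0 := by
    refine (norm_eq_iInf_iff_real_inner_le_zero hYconvex hyt_mem).1 ?_ ystar hystar_mem
    haveI : Nonempty Y := ⟨⟨yt, hyt_mem⟩⟩
    apply le_antisymm
    · exact le_ciInf fun z => hyt_proj z.1 z.2
    · exact ciInf_le (f := fun w : Y => ‖y + α • d - w‖)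
        ⟨0, by rintro _ ⟨z, rfl⟩; exact norm_nonneg _⟩ ⟨yt, hyt_mem⟩
  have h1 := hconc y ystar
  have h2 := hconc yt y
  have h3 : g yt ≤ g ystar := hystar_max hyt_mem
  have h4 := hlip y yt
  have hcs := real_inner_le_norm (gradient g y - gradient g yt) (yt - y)
  have hn : ‖y - yt‖ = ‖yt - y‖ := norm_sub_rev _ _
  rw [hn] at h2 h4
  have h5 : ⟪gradient g y - gradient g yt, yt - y⟫ ≤ L * ‖yt - y‖ ^ 2 := by
    have := mul_le_mul_of_nonneg_right h4 (norm_nonneg (yt - y))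
    nlinarith
  have e1 : y - yt = -(yt - y) := by abel
  have e2 : y + α • d - yt = α • d - (yt - y) := by abel
  have e3 : ystar - yt = (ystar - y) - (yt - y) := by abel
  rw [e1] at h2
  rw [e2, e3] at hproj
  clear hn e1 e2 e3 h4 hcs
  generalize ystar - y = a at *
  generalize yt - y = b at *
  generalize gradient g y = G at *
  generalize gradient g yt = H at *
  obtain ⟨e, rfl⟩ : ∃ e, G = d + e := ⟨G - d, by abel⟩
  have e4 : d + e - d = e := by abel
  rw [e4]
  have hL' : L ≤ 1 / (2 * α) := by
    rw [le_div_iff₀ (by positivity)] at hαL ⊢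
    linarith
  have h6 : L * ‖b‖ ^ 2 ≤ 1 / (2 * α) * ‖b‖ ^ 2 := by gcongr
  have hy1 : ⟪e, a - b⟫ ≤ 2 / μ * ‖e‖ ^ 2 + μ / 8 * ‖a - b‖ ^ 2 := by
    refine (real_inner_le_norm e (a - b)).trans ?_
    have : 2 / μ * ‖e‖ ^ 2 + μ / 8 * ‖a - b‖ ^ 2 - ‖e‖ * ‖a - b‖
        = 2 / μ * (‖e‖ - μ / 4 * ‖a - b‖) ^ 2 := by
      field_simp
      ring
    have h : 0 ≤ 2 / μ * (‖e‖ - μ / 4 * ‖a - b‖) ^ 2 := by positivity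
    linarith
  have hy2 : ‖a - b‖ ^ 2 ≤ 2 * ‖a‖ ^ 2 + 2 * ‖b‖ ^ 2 := by
    have := parallelogram_law_with_norm ℝ a b
    nlinarith [sq_nonneg ‖a + b‖]
  have hy3 := mul_le_mul_of_nonneg_left hy2 (by positivity : 0 ≤ μ / 8)
  have h7 : ⟪d, a⟫ - ⟪d, b⟫ ≤ 1 / α * ⟪b, a⟫ - 1 / α * ‖b‖ ^ 2 := by
    simp only [inner_sub_left, inner_sub_right, real_inner_smul_left,
      real_inner_self_eq_norm_sq] at hproj
    rw [← mul_sub, one_div, inv_mul_eq_div, le_div_iff₀ hα]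
    linarith
  have h8 : 1 / (2 * α) * ‖b‖ ^ 2 = 1 / α * ‖b‖ ^ 2 / 2 := by field_simp
  have h9 : 0 ≤ μ / 2 * ‖b‖ ^ 2 := by positivity
  simp only [inner_sub_left, inner_sub_right, inner_add_left, inner_neg_right] at *
  linarith
end

section
/- Let y ∈ Y, d ∈ ℝ^p, 0 < α ≤ 1/(4L), and 0 < η ≤ 1/8. Let ỹ be the metric projection of y + α·d onto Y and set y⁺ := y + η(ỹ − y). Then ‖y⁺ − y*‖² ≤ (1 − ηαμ/2)‖y − y*‖² − (3η/4)‖ỹ − y‖² + (4ηα/μ)‖∇g(y) − d‖². -/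
open scoped RealInnerProductSpace

/-- One-step contraction of the projected ascent step: with `ỹ` the projection of
`y + α d` onto `Y`, `y⁺ = y + η(ỹ − y)`, `0 < α ≤ 1/(4L)`, `0 < η ≤ 1/8`,
`‖y⁺ − y*‖² ≤ (1 − ηαμ/2)‖y − y*‖² − (3η/4)‖ỹ − y‖² + (4ηα/μ)‖∇g(y) − d‖²`. -/
theorem stmt_5
    (p : ℕ)
    (g : EuclideanSpace ℝ (Fin p) → ℝ)
    (μ L : ℝ) (hμ : 0 < μ) (hL : 0 < L)
    (hdiff : Differentiable ℝ g)
    -- `μ`-strong concavity of `g`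
    (hconc : ∀ y y', g y' ≤ g y + ⟪gradient g y, y' - y⟫ - μ / 2 * ‖y' - y‖ ^ 2)
    -- `L`-Lipschitz continuity of `∇g`
    (hlip : ∀ y y', ‖gradient g y - gradient g y'‖ ≤ L * ‖y - y'‖)
    (Y : Set (EuclideanSpace ℝ (Fin p)))
    (hYne : Y.Nonempty) (hYclosed : IsClosed Y) (hYconvex : Convex ℝ Y)
    -- `y*` is the unique maximizer of `g` over `Y`
    (ystar : EuclideanSpace ℝ (Fin p))
    (hystar_mem : ystar ∈ Y)
    (hystar_max : IsMaxOn g Y ystar)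
    (hystar_uniq : ∀ y ∈ Y, IsMaxOn g Y y → y = ystar)
    (y : EuclideanSpace ℝ (Fin p)) (hy : y ∈ Y)
    (d : EuclideanSpace ℝ (Fin p))
    (α η : ℝ) (hα : 0 < α) (hαL : α ≤ 1 / (4 * L))
    (hη : 0 < η) (hη8 : η ≤ 1 / 8)
    -- `ỹ` is the metric projection of `y + α • d` onto `Y`
    (yt : EuclideanSpace ℝ (Fin p)) (hyt_mem : yt ∈ Y)
    (hyt_proj : ∀ z ∈ Y, ‖y + α • d - yt‖ ≤ ‖y + α • d - z‖)
    (yplus : EuclideanSpace ℝ (Fin p))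
    (hyplus : yplus = y + η • (yt - y)) :
    ‖yplus - ystar‖ ^ 2 ≤ (1 - η * α * μ / 2) * ‖y - ystar‖ ^ 2
      - 3 * η / 4 * ‖yt - y‖ ^ 2 + 4 * η * α / μ * ‖gradient g y - d‖ ^ 2 := by
  have hproj : ⟪y + α • d - yt, ystar - yt⟫ ≤ 0 := by
    haveI : Nonempty Y := ⟨⟨yt, hyt_mem⟩⟩
    refine (norm_eq_iInf_iff_real_inner_le_zero hYconvex hyt_mem).1 ?_ ystar hystar_mem
    apply le_antisymm
    · exact le_ciInf fun z => hyt_proj z z.2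
    · exact ciInf_le (f := fun w : Y => ‖y + α • d - w‖)
        ⟨0, by rintro _ ⟨z, rfl⟩; exact norm_nonneg _⟩ ⟨yt, hyt_mem⟩
  have h1 := hconc y ystar
  have h2 := hconc yt y
  have h3 : g yt ≤ g ystar := hystar_max hyt_mem
  have h4 := hlip y yt
  obtain ⟨a, ha⟩ : ∃ a, a = y - ystar := ⟨_, rfl⟩
  obtain ⟨b, hb⟩ : ∃ b, b = yt - y := ⟨_, rfl⟩
  obtain ⟨G, hG⟩ : ∃ G, G = gradient g y := ⟨_, rfl⟩
  obtain ⟨H, hH⟩ : ∃ H, H = gradient g yt := ⟨_, rfl⟩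
  obtain ⟨e, he⟩ : ∃ e, e = G - d := ⟨_, rfl⟩
  have e1 : yplus - ystar = a + η • b := by rw [hyplus, ha, hb]; abel
  have e2 : y + α • d - yt = α • (G - e) - b := by rw [he, hb, sub_sub_cancel]; abel
  have e3 : ystar - yt = -(a + b) := by rw [ha, hb]; abel
  have e4 : ystar - y = -a := by rw [ha]; abel
  have e5 : y - yt = -b := by rw [hb]; abel
  rw [e2, e3] at hproj
  rw [e4, ← hG, norm_neg, inner_neg_right] at h1
  rw [e5, ← hH, norm_neg, inner_neg_right] at h2
  rw [e5, ← hG, ← hH, norm_neg] at h4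
  rw [e1, ← ha, ← hb, ← hG, ← he]
  have h5 : ⟪G, b⟫ - ⟪H, b⟫ ≤ L * ‖b‖ ^ 2 := by
    rw [← inner_sub_left]
    calc ⟪G - H, b⟫ ≤ ‖G - H‖ * ‖b‖ := real_inner_le_norm _ _
      _ ≤ L * ‖b‖ * ‖b‖ := by gcongr
      _ = _ := by ring
  have h6 : ⟪G, a⟫ + ⟪G, b⟫ ≤ L * ‖b‖ ^ 2 - μ / 2 * ‖a‖ ^ 2 - μ / 2 * ‖b‖ ^ 2 := by linarith
  have key : ∀ x : EuclideanSpace ℝ (Fin p),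
      -2 * ⟪e, x⟫ ≤ μ / 2 * ‖x‖ ^ 2 + 2 / μ * ‖e‖ ^ 2 := by
    intro x
    have c1 : -⟪e, x⟫ ≤ ‖e‖ * ‖x‖ := (neg_le_abs _).trans (abs_real_inner_le_norm _ _)
    have c2 : μ / 2 * ‖x‖ ^ 2 + 2 / μ * ‖e‖ ^ 2 - 2 * (‖e‖ * ‖x‖)
        = (μ * ‖x‖ - 2 * ‖e‖) ^ 2 / (2 * μ) := by field_simp; ring
    have c3 : 0 ≤ (μ * ‖x‖ - 2 * ‖e‖) ^ 2 / (2 * μ) := by positivity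
    linarith
  have ka := key a
  have kb := key b
  have hαL' : α * L ≤ 1 / 4 := by
    rw [le_div_iff₀ (by positivity)] at hαL
    linarith
  simp only [inner_neg_right, inner_sub_left, inner_add_right, real_inner_smul_left,
    real_inner_self_eq_norm_sq] at hproj
  rw [real_inner_comm a b] at hproj
  rw [norm_add_sq_real, real_inner_smul_right, norm_smul, Real.norm_of_nonneg hη.le]
  have h7 := mul_le_mul_of_nonneg_left (add_le_add (add_le_add ka kb)
    (mul_le_mul_of_nonneg_left h6 (by norm_num : (0:ℝ) ≤ 2))) hα.le
  have h8 := mul_le_mul_of_nonneg_right hαL' (sq_nonneg ‖b‖)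
  have h9 := mul_le_mul_of_nonneg_right hη8 (sq_nonneg ‖b‖)
  have hb2 := sq_nonneg ‖b‖
  have h10 : 2 * ⟪a, b⟫ + η * ‖b‖ ^ 2 ≤ -(α * μ / 2) * ‖a‖ ^ 2 - 3 / 4 * ‖b‖ ^ 2
      + 4 * α / μ * ‖e‖ ^ 2 := by
    have : 4 * α / μ * ‖e‖ ^ 2 = 2 * (α * (2 / μ * ‖e‖ ^ 2)) := by ring
    have : 0 ≤ α * μ * ‖b‖ ^ 2 := by positivity
    nlinarith
  have h11 := mul_le_mul_of_nonneg_left h10 hη.le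
  have : 4 * η * α / μ * ‖e‖ ^ 2 = η * (4 * α / μ * ‖e‖ ^ 2) := by ring
  rw [this]
  nlinarith
end

section
/- Let x̄, x̃ ∈ ℝ^{p1}, ȳ ∈ Y, d ∈ ℝ^{p2}, ν > 0, 0 < α ≤ 1/(4L_f), and 0 < η ≤ 1/8. Let ỹ be the metric projection of ȳ + α·d onto Y, and set ȳ⁺ := ȳ + η(ỹ − ȳ) and x̄⁺ := x̄ + ν(x̃ − x̄). Then the tracking error with respect to the moving maximizer satisfies ‖ȳ⁺ − y*(x̄⁺)‖² ≤ (1 − μηα/4)‖ȳ − y*(x̄)‖² − (3η/4)‖ỹ − ȳ‖² + (75ηα/(16μ))‖d − ∇_y F(x̄, ȳ)‖² + (17 L_f² ν²/(2 μ³ η α))‖x̃ − x̄‖². -/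
open scoped RealInnerProductSpace

lemma aux_vi {E : Type*} [NormedAddCommGroup E] [InnerProductSpace ℝ E] [CompleteSpace E]
    (f : E → ℝ) (hf : Differentiable ℝ f) (Y : Set E) (hY : Convex ℝ Y) (s z : E)
    (hs : s ∈ Y) (hz : z ∈ Y) (hmax : IsMaxOn f Y s) : ⟪gradient f s, z - s⟫ ≤ 0 := by
  have h1 : HasFDerivWithinAt f (fderiv ℝ f s) Y s := (hf s).hasFDerivAt.hasFDerivWithinAt
  have h2 := hmax.localize.hasFDerivWithinAt_nonpos h1
    (sub_mem_posTangentConeAt_of_segment_subset (hY.segment_subset hs hz))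
  rw [gradient, InnerProductSpace.toDual_symm_apply]
  exact h2

lemma aux_proj {E : Type*} [NormedAddCommGroup E] [InnerProductSpace ℝ E]
    (Y : Set E) (hY : Convex ℝ Y) (u v z : E) (hv : v ∈ Y) (hz : z ∈ Y)
    (h : ∀ z ∈ Y, ‖u - v‖ ≤ ‖u - z‖) : ⟪u - v, z - v⟫ ≤ 0 := by
  refine (norm_eq_iInf_iff_real_inner_le_zero hY hv).1 ?_ z hz
  haveI : Nonempty Y := ⟨⟨v, hv⟩⟩
  apply le_antisymm
  · exact le_ciInf fun w => h w w.2
  · exact ciInf_le (f := fun w : Y => ‖u - w‖) ⟨0, by rintro _ ⟨w, rfl⟩; exact norm_nonneg _⟩ ⟨v, hv⟩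

lemma aux_young {E : Type*} [NormedAddCommGroup E] [InnerProductSpace ℝ E]
    (a b : E) (c : ℝ) (hc : 0 < c) :
    ‖a + b‖ ^ 2 ≤ (1 + c) * ‖a‖ ^ 2 + (1 + 1 / c) * ‖b‖ ^ 2 := by
  have h1 : ‖a + b‖ ^ 2 ≤ (‖a‖ + ‖b‖) ^ 2 := by gcongr; exact norm_add_le a b
  have h2 : (1 + c) * ‖a‖ ^ 2 + (1 + 1 / c) * ‖b‖ ^ 2 - (‖a‖ + ‖b‖) ^ 2
      = (c * ‖a‖ - ‖b‖) ^ 2 / c := by field_simp; ring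
  have h3 : 0 ≤ (c * ‖a‖ - ‖b‖) ^ 2 / c := by positivity
  linarith

lemma aux_step {E : Type*} [NormedAddCommGroup E] [InnerProductSpace ℝ E]
    (y yt s d g gt : E) (f fs ft L μ α η : ℝ) (hL : 0 < L) (hμ : 0 < μ) (hα : 0 < α)
    (hαL : α * L ≤ 1 / 4) (hη : 0 < η) (hη8 : η ≤ 1 / 8)
    (h1 : fs ≤ f + ⟪g, s - y⟫ - μ / 2 * ‖s - y‖ ^ 2)
    (h2 : f ≤ ft + ⟪gt, y - yt⟫ - μ / 2 * ‖y - yt‖ ^ 2)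
    (h3 : ft ≤ fs - μ / 2 * ‖yt - s‖ ^ 2)
    (h4 : ‖g - gt‖ ≤ L * ‖y - yt‖)
    (h5 : ⟪y + α • d - yt, s - yt⟫ ≤ 0) :
    ‖y + η • (yt - y) - s‖ ^ 2 ≤ (1 - μ * η * α) * ‖y - s‖ ^ 2
      - 11 / 8 * η * ‖yt - y‖ ^ 2 + η * α / μ * ‖d - g‖ ^ 2 := by
  obtain ⟨w, rfl⟩ : ∃ w, yt = y + w := ⟨yt - y, by abel⟩
  obtain ⟨r, rfl⟩ : ∃ r, s = y + r := ⟨s - y, by abel⟩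
  obtain ⟨e, rfl⟩ : ∃ e, d = g + e := ⟨d - g, by abel⟩
  have e1 : y + r - y = r := by abel
  have e2 : y - (y + w) = -w := by abel
  have e3 : y + w - (y + r) = -(r - w) := by abel
  have e4 : y + α • (g + e) - (y + w) = α • g + α • e - w := by rw [smul_add]; abel
  have e5 : y + r - (y + w) = r - w := by abel
  have e6 : y + η • (y + w - y) - (y + r) = η • w - r := by
    rw [show y + w - y = w by abel]; abel
  have e7 : y - (y + r) = -r := by abel
  have e8 : y + w - y = w := by abel
  have e9 : g + e - g = e := by abel
  rw [e1] at h1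
  rw [e2, norm_neg, inner_neg_right] at h2
  rw [e3, norm_neg] at h3
  rw [e2, norm_neg] at h4
  rw [e4, e5] at h5
  rw [e6, e7, e8, e9, norm_neg]
  have h6 : ⟪g - gt, w⟫ ≤ L * ‖w‖ ^ 2 := by
    calc ⟪g - gt, w⟫ ≤ ‖g - gt‖ * ‖w‖ := real_inner_le_norm _ _
      _ ≤ L * ‖w‖ * ‖w‖ := by gcongr
      _ = _ := by ring
  have h7 : -⟪e, r - w⟫ ≤ μ / 2 * ‖r - w‖ ^ 2 + 1 / (2 * μ) * ‖e‖ ^ 2 := by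
    have a1 : -⟪e, r - w⟫ ≤ ‖e‖ * ‖r - w‖ := by
      rw [← inner_neg_left, ← norm_neg e]; exact real_inner_le_norm _ _
    have a2 : μ / 2 * ‖r - w‖ ^ 2 + 1 / (2 * μ) * ‖e‖ ^ 2 - ‖e‖ * ‖r - w‖
      = (μ * ‖r - w‖ - ‖e‖) ^ 2 / (2 * μ) := by field_simp; ring
    have a3 : 0 ≤ (μ * ‖r - w‖ - ‖e‖) ^ 2 / (2 * μ) := by positivity
    linarith
  have h8 : ‖η • w - r‖ ^ 2 = η ^ 2 * ‖w‖ ^ 2 - 2 * η * ⟪w, r⟫ + ‖r‖ ^ 2 := by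
    rw [norm_sub_sq_real, inner_smul_left, norm_smul, mul_pow, Real.norm_eq_abs, sq_abs]
    simp; ring
  simp only [inner_sub_left, inner_add_left, inner_smul_left, inner_sub_right, conj_trivial,
    real_inner_self_eq_norm_sq] at h5 h6 h7
  have hw : 0 ≤ ‖w‖ ^ 2 := by positivity
  have k1 : -(⟪g, r⟫ - ⟪g, w⟫) - (⟪e, r⟫ - ⟪e, w⟫) ≤
      -(μ / 2 * ‖r‖ ^ 2) + L * ‖w‖ ^ 2 + 1 / (2 * μ) * ‖e‖ ^ 2 := by
    nlinarith
  have k2 := mul_le_mul_of_nonneg_left k1 hα.le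
  have k3 := mul_le_mul_of_nonneg_right hαL hw
  have k4 : -⟪w, r⟫ ≤ -(3 / 4 * ‖w‖ ^ 2) - α * μ / 2 * ‖r‖ ^ 2 + α * (1 / (2 * μ)) * ‖e‖ ^ 2 := by
    nlinarith
  have k5 := mul_le_mul_of_nonneg_left k4 (by positivity : 0 ≤ 2 * η)
  have k6 : η * η * ‖w‖ ^ 2 ≤ η * (1 / 8) * ‖w‖ ^ 2 := by gcongr
  have k7 : η * α / μ * ‖e‖ ^ 2 = 2 * η * (α * (1 / (2 * μ)) * ‖e‖ ^ 2) := by field_simp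
  rw [h8, k7]
  nlinarith

/-- Tracking-error contraction with respect to the moving maximizer:
`‖ȳ⁺ − y*(x̄⁺)‖² ≤ (1 − μηα/4)‖ȳ − y*(x̄)‖² − (3η/4)‖ỹ − ȳ‖²
  + (75ηα/(16μ))‖d − ∇_y F(x̄, ȳ)‖² + (17 L_f² ν²/(2 μ³ η α))‖x̃ − x̄‖²`. -/
theorem stmt_6
    (p1 p2 : ℕ)
    (F : EuclideanSpace ℝ (Fin p1) → EuclideanSpace ℝ (Fin p2) → ℝ)
    (Lf μ : ℝ) (hLf : 0 < Lf) (hμ : 0 < μ)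
    (Y : Set (EuclideanSpace ℝ (Fin p2)))
    (hYne : Y.Nonempty) (hYclosed : IsClosed Y) (hYconvex : Convex ℝ Y)
    (hdiffx : ∀ y, Differentiable ℝ (fun x => F x y))
    (hdiffy : ∀ x, Differentiable ℝ (fun y => F x y))
    -- `L_f`-Lipschitz continuity of the (joint) gradient of `F`
    (hlip : ∀ x x' y y',
      ‖gradient (fun u => F u y) x - gradient (fun u => F u y') x'‖ ^ 2
        + ‖gradient (fun v => F x v) y - gradient (fun v => F x' v) y'‖ ^ 2
      ≤ Lf ^ 2 * (‖x - x'‖ ^ 2 + ‖y - y'‖ ^ 2))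
    -- `μ`-strong concavity of `y ↦ F x y` for every fixed `x`
    (hconc : ∀ x y y', F x y' ≤ F x y + ⟪gradient (fun v => F x v) y, y' - y⟫
      - μ / 2 * ‖y' - y‖ ^ 2)
    -- `y*(x)` is the unique maximizer of `F x ·` over `Y`
    (ystar : EuclideanSpace ℝ (Fin p1) → EuclideanSpace ℝ (Fin p2))
    (hystar_mem : ∀ x, ystar x ∈ Y)
    (hystar_max : ∀ x, IsMaxOn (fun y => F x y) Y (ystar x))
    (hystar_uniq : ∀ x y, y ∈ Y → IsMaxOn (fun y' => F x y') Y y → y = ystar x)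
    -- iterates and parameters
    (xbar xt : EuclideanSpace ℝ (Fin p1))
    (ybar : EuclideanSpace ℝ (Fin p2)) (hybar : ybar ∈ Y)
    (d : EuclideanSpace ℝ (Fin p2))
    (ν α η : ℝ) (hν : 0 < ν)
    (hα : 0 < α) (hαL : α ≤ 1 / (4 * Lf))
    (hη : 0 < η) (hη8 : η ≤ 1 / 8)
    -- `ỹ` is the metric projection of `ȳ + α • d` onto `Y`
    (yt : EuclideanSpace ℝ (Fin p2)) (hyt_mem : yt ∈ Y)
    (hyt_proj : ∀ z ∈ Y, ‖ybar + α • d - yt‖ ≤ ‖ybar + α • d - z‖)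
    (ybarplus : EuclideanSpace ℝ (Fin p2))
    (hybarplus : ybarplus = ybar + η • (yt - ybar))
    (xbarplus : EuclideanSpace ℝ (Fin p1))
    (hxbarplus : xbarplus = xbar + ν • (xt - xbar)) :
    ‖ybarplus - ystar xbarplus‖ ^ 2 ≤
      (1 - μ * η * α / 4) * ‖ybar - ystar xbar‖ ^ 2
      - 3 * η / 4 * ‖yt - ybar‖ ^ 2
      + 75 * η * α / (16 * μ) * ‖d - gradient (fun v => F xbar v) ybar‖ ^ 2
      + 17 * Lf ^ 2 * ν ^ 2 / (2 * μ ^ 3 * η * α) * ‖xt - xbar‖ ^ 2 := by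
  rcases subsingleton_or_nontrivial (EuclideanSpace ℝ (Fin p2)) with hsub | hnt
  · rw [Subsingleton.elim (ybarplus - ystar xbarplus) 0, Subsingleton.elim (ybar - ystar xbar) 0,
      Subsingleton.elim (yt - ybar) 0]
    simp only [norm_zero]
    have h1 : 0 ≤ 75 * η * α / (16 * μ) * ‖d - gradient (fun v => F xbar v) ybar‖ ^ 2 := by
      positivity
    have h2 : 0 ≤ 17 * Lf ^ 2 * ν ^ 2 / (2 * μ ^ 3 * η * α) * ‖xt - xbar‖ ^ 2 := by positivity
    linarith
  -- Lipschitz in y and in x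
  have lipy : ∀ x y y', ‖gradient (fun v => F x v) y - gradient (fun v => F x v) y'‖
      ≤ Lf * ‖y - y'‖ := by
    intro x y y'
    have h := hlip x x y y'
    refine (sq_le_sq₀ (norm_nonneg _) (by positivity)).1 ?_
    rw [sub_self x, norm_zero] at h
    nlinarith [sq_nonneg ‖gradient (fun u => F u y) x - gradient (fun u => F u y') x‖]
  have lipx : ∀ x x' y, ‖gradient (fun v => F x v) y - gradient (fun v => F x' v) y‖
      ≤ Lf * ‖x - x'‖ := by
    intro x x' y
    have h := hlip x x' y y
    refine (sq_le_sq₀ (norm_nonneg _) (by positivity)).1 ?_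
    rw [sub_self y, norm_zero] at h
    nlinarith [sq_nonneg ‖gradient (fun u => F u y) x - gradient (fun u => F u y) x'‖]
  have mono : ∀ x y y', μ * ‖y' - y‖ ^ 2 ≤
      ⟪gradient (fun v => F x v) y, y' - y⟫ - ⟪gradient (fun v => F x v) y', y' - y⟫ := by
    intro x y y'
    have h1 := hconc x y y'
    have h2 := hconc x y' y
    rw [← neg_sub y' y, norm_neg, inner_neg_right] at h2
    linarith
  have vi : ∀ x, ∀ z ∈ Y, ⟪gradient (fun v => F x v) (ystar x), z - ystar x⟫ ≤ 0 :=
    fun x z hz => aux_vi _ (hdiffy x) Y hYconvex _ z (hystar_mem x) hz (hystar_max x)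
  have hμL : μ ≤ Lf := by
    obtain ⟨a, b, hab⟩ := exists_pair_ne (EuclideanSpace ℝ (Fin p2))
    have hpos : 0 < ‖b - a‖ := norm_pos_iff.2 (sub_ne_zero.2 hab.symm)
    have h1 := mono xbar a b
    rw [← inner_sub_left] at h1
    have h2 := real_inner_le_norm
      (gradient (fun v => F xbar v) a - gradient (fun v => F xbar v) b) (b - a)
    have h3 := mul_le_mul_of_nonneg_right (lipy xbar a b) hpos.le
    rw [norm_sub_rev a b] at h3
    have h4 : μ * ‖b - a‖ ^ 2 ≤ Lf * ‖b - a‖ ^ 2 := by nlinarith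
    exact le_of_mul_le_mul_right h4 (by positivity)
  have hαL' : α * Lf ≤ 1 / 4 := by
    rw [le_div_iff₀ (by positivity)] at hαL
    linarith
  have hstep := aux_step ybar yt (ystar xbar) d (gradient (fun v => F xbar v) ybar)
    (gradient (fun v => F xbar v) yt) (F xbar ybar) (F xbar (ystar xbar)) (F xbar yt)
    Lf μ α η hLf hμ hα hαL' hη hη8 (hconc _ _ _) (hconc _ _ _)
    (by linarith [hconc xbar (ystar xbar) yt, vi xbar yt hyt_mem]) (lipy _ _ _)
    (aux_proj Y hYconvex _ _ _ hyt_mem (hystar_mem _) hyt_proj)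
  rw [← hybarplus] at hstep
  have hys : μ * ‖ystar xbar - ystar xbarplus‖ ≤ Lf * (ν * ‖xt - xbar‖) := by
    have hx : ‖xbarplus - xbar‖ = ν * ‖xt - xbar‖ := by
      rw [hxbarplus, add_sub_cancel_left, norm_smul, Real.norm_of_nonneg hν.le]
    rw [← hx]
    rcases (norm_nonneg (ystar xbar - ystar xbarplus)).eq_or_lt with h0 | hpos
    · rw [← h0]; simp only [mul_zero]; positivity
    have h1 := mono xbarplus (ystar xbarplus) (ystar xbar)
    have h2 := mono xbarplus (ystar xbar) (ystar xbarplus)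
    have h3 := vi xbar _ (hystar_mem xbarplus)
    have h4 := vi xbarplus _ (hystar_mem xbar)
    have h5 := real_inner_le_norm (gradient (fun v => F xbarplus v) (ystar xbar)
      - gradient (fun v => F xbar v) (ystar xbar)) (ystar xbarplus - ystar xbar)
    have h6 := mul_le_mul_of_nonneg_right (lipx xbarplus xbar (ystar xbar))
      (norm_nonneg (ystar xbarplus - ystar xbar))
    rw [← neg_sub (ystar xbar) (ystar xbarplus)] at h2 h3 h5 h6
    rw [inner_sub_left] at h5
    simp only [norm_neg, inner_neg_right] at h2 h3 h5 h6
    have h7 : μ * ‖ystar xbar - ystar xbarplus‖ * ‖ystar xbar - ystar xbarplus‖ ≤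
      Lf * ‖xbarplus - xbar‖ * ‖ystar xbar - ystar xbarplus‖ := by nlinarith
    exact le_of_mul_le_mul_right h7 hpos
  have ht : 0 < μ * η * α := by positivity
  have ht1 : μ * η * α ≤ 1 / 32 := by
    have : μ * α ≤ 1 / 4 := by nlinarith
    have h8 : (μ * α) * η ≤ 1 / 4 * (1 / 8) := by gcongr
    nlinarith
  have hy := aux_young (ybarplus - ystar xbar) (ystar xbar - ystar xbarplus) (μ * η * α / 4)
    (by positivity)
  rw [sub_add_sub_cancel] at hy
  have hB : (1 + 1 / (μ * η * α / 4)) * ‖ystar xbar - ystar xbarplus‖ ^ 2 ≤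
      17 * Lf ^ 2 * ν ^ 2 / (2 * μ ^ 3 * η * α) * ‖xt - xbar‖ ^ 2 := by
    have b1 : 1 + 1 / (μ * η * α / 4) ≤ 17 / (2 * (μ * η * α)) := by
      rw [← sub_nonneg]
      have : 17 / (2 * (μ * η * α)) - (1 + 1 / (μ * η * α / 4)) =
        (9 / 2 - μ * η * α) / (μ * η * α) := by field_simp; ring
      rw [this]
      apply div_nonneg <;> linarith
    have b2 : ‖ystar xbar - ystar xbarplus‖ ≤ Lf * (ν * ‖xt - xbar‖) / μ := by
      rw [le_div_iff₀ hμ]; linarith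
    calc _ ≤ 17 / (2 * (μ * η * α)) * (Lf * (ν * ‖xt - xbar‖) / μ) ^ 2 := by gcongr
      _ = _ := by field_simp
  have hA := mul_le_mul_of_nonneg_left hstep (by positivity : 0 ≤ 1 + μ * η * α / 4)
  set t := μ * η * α with htdef
  have c1 : (1 + t / 4) * (1 - t) * ‖ybar - ystar xbar‖ ^ 2 ≤
      (1 - t / 4) * ‖ybar - ystar xbar‖ ^ 2 := by
    gcongr; nlinarith
  have c2 : 3 * η / 4 * ‖yt - ybar‖ ^ 2 ≤ (1 + t / 4) * (11 / 8 * η * ‖yt - ybar‖ ^ 2) := by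
    have : 0 ≤ η * ‖yt - ybar‖ ^ 2 := by positivity
    nlinarith
  have c3 : (1 + t / 4) * (η * α / μ * ‖d - gradient (fun v => F xbar v) ybar‖ ^ 2) ≤
      75 * η * α / (16 * μ) * ‖d - gradient (fun v => F xbar v) ybar‖ ^ 2 := by
    have e : 75 * η * α / (16 * μ) * ‖d - gradient (fun v => F xbar v) ybar‖ ^ 2 =
      75 / 16 * (η * α / μ * ‖d - gradient (fun v => F xbar v) ybar‖ ^ 2) := by field_simp
    rw [e]
    gcongr
    linarith
  linarith
end

section
/- Fix m ≥ 1 points x₁,…,x_m ∈ X with average x̄ = (1/m)Σᵢ xᵢ, vectors p₁,…,p_m ∈ ℝ^{p1}, parameters τ > 0, β > 0, 0 < ν ≤ 1, and any ȳ ∈ ℝ^{p2}. For each i let x̃ᵢ be a minimizer over X of x ↦ ⟨pᵢ, x − xᵢ⟩ + (τ/2)‖x − xᵢ‖² + h(x), and set x̄⁺ := x̄ + ν((1/m)Σᵢ x̃ᵢ − x̄). Then the descent inequality Q(x̄⁺) − Q(x̄) ≤ (ν L_f²/(2β))‖y*(x̄) − ȳ‖² + (ν/(2βm))Σᵢ‖∇_x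 F(x̄, ȳ) − pᵢ‖² + (ντ/(2βm))Σᵢ‖xᵢ − x̄‖² − (ντ/m − ν²L_J/(2m) − νβ/m − ντβ/(2m))·Σᵢ‖x̃ᵢ − x̄‖² holds, where L_J := L_f + L_f²/μ. (When all pᵢ equal their average p̄, the middle term becomes (ν/(2β))‖∇_x F(x̄,ȳ) − p̄‖², which is the form stated in the paper.) -/
open scoped RealInnerProductSpace

theorem aux_limit (a b c : ℝ) (H : ∀ t : ℝ, 0 < t → t < 1 → a ≤ b + t * c) : a ≤ b := by
  have hT : Filter.Tendsto (fun t : ℝ => b + t * c) (nhdsWithin 0 (Set.Ioi 0)) (nhds b) := by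
    have : Filter.Tendsto (fun t : ℝ => b + t * c) (nhds 0) (nhds (b + 0 * c)) :=
      (by fun_prop : Continuous (fun t : ℝ => b + t * c)).tendsto 0
    simp only [zero_mul, add_zero] at this
    exact this.mono_left nhdsWithin_le_nhds
  refine ge_of_tendsto hT ?_
  filter_upwards [Ioo_mem_nhdsGT (zero_lt_one' ℝ)] with t ht
  exact H t ht.1 ht.2

theorem aux_descent {n : ℕ} (f : EuclideanSpace ℝ (Fin n) → ℝ) (L : ℝ)
    (hf : Differentiable ℝ f)
    (hL : ∀ x x', ‖gradient f x - gradient f x'‖ ≤ L * ‖x - x'‖)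
    (x d : EuclideanSpace ℝ (Fin n)) :
    f (x + d) ≤ f x + ⟪gradient f x, d⟫ + L / 2 * ‖d‖ ^ 2 := by
  have hder : ∀ t : ℝ, HasDerivAt
      (fun t : ℝ => f (x + t • d) - t * ⟪gradient f x, d⟫ - L / 2 * ‖d‖ ^ 2 * t ^ 2)
      (⟪gradient f (x + t • d), d⟫ - ⟪gradient f x, d⟫ - L * ‖d‖ ^ 2 * t) t := by
    intro t
    have h1 : HasDerivAt (fun t : ℝ => x + t • d) d t := by
      simpa using ((hasDerivAt_id t).smul_const d).const_add x
    have h2 := (hf (x + t • d)).hasGradientAt.hasFDerivAt.comp_hasDerivAt t h1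
    have h3 := (h2.sub ((hasDerivAt_id t).mul_const ⟪gradient f x, d⟫)).sub
      ((hasDerivAt_pow 2 t).const_mul (L / 2 * ‖d‖ ^ 2))
    refine h3.congr_deriv ?_
    simp only [InnerProductSpace.toDual_apply_apply]
    push_cast
    ring
  have hanti : AntitoneOn
      (fun t : ℝ => f (x + t • d) - t * ⟪gradient f x, d⟫ - L / 2 * ‖d‖ ^ 2 * t ^ 2)
      (Set.Ici 0) := by
    refine antitoneOn_of_deriv_nonpos (convex_Ici 0)
      (fun t _ => (hder t).continuousAt.continuousWithinAt)
      (fun t _ => (hder t).differentiableAt.differentiableWithinAt) ?_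
    intro t ht
    rw [interior_Ici] at ht
    have ht0 : (0 : ℝ) < t := ht
    rw [(hder t).deriv, ← inner_sub_left]
    have h1 := real_inner_le_norm (gradient f (x + t • d) - gradient f x) d
    have h2 := hL (x + t • d) x
    rw [add_sub_cancel_left, norm_smul, Real.norm_of_nonneg ht0.le] at h2
    have h3 := mul_le_mul_of_nonneg_right h2 (norm_nonneg d)
    nlinarith
  have := hanti (Set.mem_Ici.2 le_rfl) (Set.mem_Ici.2 zero_le_one) zero_le_one
  simp only [one_smul, zero_smul, add_zero] at this
  linarith

theorem aux_young_s7 {n : ℕ} (a b : EuclideanSpace ℝ (Fin n)) (β : ℝ) (hβ : 0 < β) :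
    ⟪a, b⟫ ≤ 1 / (2 * β) * ‖a‖ ^ 2 + β / 2 * ‖b‖ ^ 2 := by
  have h1 := real_inner_le_norm a b
  have h2 : 1 / (2 * β) * ‖a‖ ^ 2 + β / 2 * ‖b‖ ^ 2 - ‖a‖ * ‖b‖
      = 1 / (2 * β) * (‖a‖ - β * ‖b‖) ^ 2 := by
    field_simp
    ring
  have h3 : 0 ≤ 1 / (2 * β) * (‖a‖ - β * ‖b‖) ^ 2 := by positivity
  linarith

theorem aux_conc {n : ℕ} (f : EuclideanSpace ℝ (Fin n) → ℝ) (μ : ℝ)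
    (g : EuclideanSpace ℝ (Fin n) → EuclideanSpace ℝ (Fin n))
    (hconc : ∀ y y', f y' ≤ f y + ⟪g y, y' - y⟫ - μ / 2 * ‖y' - y‖ ^ 2)
    (Y : Set (EuclideanSpace ℝ (Fin n))) (hY : Convex ℝ Y)
    (s y : EuclideanSpace ℝ (Fin n)) (hs : s ∈ Y) (hy : y ∈ Y) (hmax : IsMaxOn f Y s) :
    f y ≤ f s - μ / 2 * ‖y - s‖ ^ 2 := by
  refine aux_limit _ _ (μ / 2 * ‖y - s‖ ^ 2) ?_
  intro t ht ht1
  have hz : s + t • (y - s) ∈ Y := hY.add_smul_sub_mem hs hy ⟨ht.le, ht1.le⟩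
  have h0 : f (s + t • (y - s)) ≤ f s := hmax hz
  have h1 := hconc (s + t • (y - s)) y
  have h2 := hconc (s + t • (y - s)) s
  rw [show y - (s + t • (y - s)) = (1 - t) • (y - s) by module, norm_smul,
    inner_smul_right, mul_pow, Real.norm_eq_abs, sq_abs] at h1
  rw [show s - (s + t • (y - s)) = (-t) • (y - s) by module, norm_smul,
    inner_smul_right, mul_pow, Real.norm_eq_abs, sq_abs] at h2
  generalize ⟪g (s + t • (y - s)), y - s⟫ = G at *
  generalize ‖y - s‖ ^ 2 = D at *
  have h3 := mul_le_mul_of_nonneg_left h1 ht.le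
  have h4 := mul_le_mul_of_nonneg_left h2 (sub_nonneg.2 ht1.le)
  have h5 : t * f y ≤ t * (f s - μ / 2 * D + t * (μ / 2 * D)) := by nlinarith
  exact le_of_mul_le_mul_left h5 ht

theorem aux_prox {n : ℕ} (h : EuclideanSpace ℝ (Fin n) → ℝ) (hconv : ConvexOn ℝ Set.univ h)
    (X : Set (EuclideanSpace ℝ (Fin n))) (hX : Convex ℝ X) (τ : ℝ)
    (p a s x : EuclideanSpace ℝ (Fin n)) (hs : s ∈ X) (hx : x ∈ X)
    (hmin : IsMinOn (fun x => ⟪p, x - a⟫ + τ / 2 * ‖x - a‖ ^ 2 + h x) X s) :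
    h s - h x ≤ - ⟪p, s - x⟫ - τ * ‖s - x‖ ^ 2 + τ * ⟪a - x, s - x⟫ := by
  refine aux_limit _ _ (τ / 2 * ‖s - x‖ ^ 2) ?_
  intro t ht ht1
  have hz : s + t • (x - s) ∈ X := hX.add_smul_sub_mem hs hx ⟨ht.le, ht1.le⟩
  have h0 : ⟪p, s - a⟫ + τ / 2 * ‖s - a‖ ^ 2 + h s ≤ ⟪p, s + t • (x - s) - a⟫
    + τ / 2 * ‖s + t • (x - s) - a‖ ^ 2 + h (s + t • (x - s)) := hmin hz
  have h1 := hconv.2 (Set.mem_univ s) (Set.mem_univ x) (sub_nonneg.2 ht1.le) ht.le (by ring)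
  rw [show (1 - t) • s + t • x = s + t • (x - s) by module] at h1
  simp only [smul_eq_mul] at h1
  have e1 : s + t • (x - s) - a = (s - x) - (a - x) - t • (s - x) := by module
  have e2 : s - a = (s - x) - (a - x) := by module
  rw [e1, e2] at h0
  generalize s - x = d at *
  generalize a - x = b at *
  rw [norm_sub_sq_real (d - b) (t • d), norm_smul, mul_pow, Real.norm_eq_abs, sq_abs] at h0
  simp only [inner_sub_right, inner_sub_left, inner_smul_right, real_inner_self_eq_norm_sq] at h0
  generalize ‖d‖ ^ 2 = D at *
  have hc : ⟪d, b⟫ = ⟪b, d⟫ := real_inner_comm _ _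
  refine le_of_mul_le_mul_left (a := t) ?_ ht
  nlinarith

theorem aux_jensen {n m : ℕ} (hm : 0 < m) (h : EuclideanSpace ℝ (Fin n) → ℝ)
    (hconv : ConvexOn ℝ Set.univ h) (x : Fin m → EuclideanSpace ℝ (Fin n)) :
    h ((m : ℝ)⁻¹ • ∑ i, x i) ≤ (m : ℝ)⁻¹ * ∑ i, h (x i) := by
  have hm' : (m : ℝ) ≠ 0 := by positivity
  have := hconv.map_sum_le (t := Finset.univ) (w := fun _ : Fin m => (m : ℝ)⁻¹) (p := x)
    (fun _ _ => by positivity) (by simp [hm']) (fun _ _ => Set.mem_univ _)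
  simpa [Finset.smul_sum, Finset.mul_sum] using this

/-- Descent inequality on `Q = J + h` for the proximal consensus update. -/
theorem stmt_7
    (p1 p2 : ℕ)
    (F : EuclideanSpace ℝ (Fin p1) → EuclideanSpace ℝ (Fin p2) → ℝ)
    (Lf μ : ℝ) (hLf : 0 < Lf) (hμ : 0 < μ)
    (Y : Set (EuclideanSpace ℝ (Fin p2)))
    (hYne : Y.Nonempty) (hYclosed : IsClosed Y) (hYconvex : Convex ℝ Y)
    (hdiffx : ∀ y, Differentiable ℝ (fun x => F x y))
    (hdiffy : ∀ x, Differentiable ℝ (fun y => F x y))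
    -- `L_f`-Lipschitz continuity of the (joint) gradient of `F`
    (hlip : ∀ x x' y y',
      ‖gradient (fun u => F u y) x - gradient (fun u => F u y') x'‖ ^ 2
        + ‖gradient (fun v => F x v) y - gradient (fun v => F x' v) y'‖ ^ 2
      ≤ Lf ^ 2 * (‖x - x'‖ ^ 2 + ‖y - y'‖ ^ 2))
    -- `μ`-strong concavity of `y ↦ F x y` for every fixed `x`
    (hconc : ∀ x y y', F x y' ≤ F x y + ⟪gradient (fun v => F x v) y, y' - y⟫
      - μ / 2 * ‖y' - y‖ ^ 2)
    -- `y*(x)` is the unique maximizer of `F x ·` over `Y`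
    (ystar : EuclideanSpace ℝ (Fin p1) → EuclideanSpace ℝ (Fin p2))
    (hystar_mem : ∀ x, ystar x ∈ Y)
    (hystar_max : ∀ x, IsMaxOn (fun y => F x y) Y (ystar x))
    (hystar_uniq : ∀ x y, y ∈ Y → IsMaxOn (fun y' => F x y') Y y → y = ystar x)
    -- the constrained minimization side: `X`, `h`, `J`, `Q`
    (X : Set (EuclideanSpace ℝ (Fin p1)))
    (hXne : X.Nonempty) (hXclosed : IsClosed X) (hXconvex : Convex ℝ X)
    (h : EuclideanSpace ℝ (Fin p1) → ℝ) (hconv : ConvexOn ℝ Set.univ h)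
    (J Q : EuclideanSpace ℝ (Fin p1) → ℝ)
    (hJ : ∀ x, IsGreatest ((fun y => F x y) '' Y) (J x))
    (hQ : ∀ x, Q x = J x + h x)
    -- agents' points, directions and parameters
    (m : ℕ) (hm : 0 < m)
    (xs : Fin m → EuclideanSpace ℝ (Fin p1)) (hxs : ∀ i, xs i ∈ X)
    (ps : Fin m → EuclideanSpace ℝ (Fin p1))
    (τ β ν : ℝ) (hτ : 0 < τ) (hβ : 0 < β) (hν : 0 < ν) (hν1 : ν ≤ 1)
    (ybar : EuclideanSpace ℝ (Fin p2))
    (xbar : EuclideanSpace ℝ (Fin p1))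
    (hxbar : xbar = (m : ℝ)⁻¹ • ∑ i, xs i)
    -- `x̃ᵢ` minimizes the proximal subproblem of agent `i` over `X`
    (xt : Fin m → EuclideanSpace ℝ (Fin p1))
    (hxt_mem : ∀ i, xt i ∈ X)
    (hxt_min : ∀ i, IsMinOn
      (fun x => ⟪ps i, x - xs i⟫ + τ / 2 * ‖x - xs i‖ ^ 2 + h x) X (xt i))
    (xbarplus : EuclideanSpace ℝ (Fin p1))
    (hxbarplus : xbarplus = xbar + ν • ((m : ℝ)⁻¹ • ∑ i, xt i - xbar)) :
    Q xbarplus - Q xbar ≤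
      ν * Lf ^ 2 / (2 * β) * ‖ystar xbar - ybar‖ ^ 2
      + ν / (2 * β * m) * ∑ i, ‖gradient (fun u => F u ybar) xbar - ps i‖ ^ 2
      + ν * τ / (2 * β * m) * ∑ i, ‖xs i - xbar‖ ^ 2
      - (ν * τ / m - ν ^ 2 * (Lf + Lf ^ 2 / μ) / (2 * m) - ν * β / m
          - ν * τ * β / (2 * m)) * ∑ i, ‖xt i - xbar‖ ^ 2 := by
  have hm0 : (0 : ℝ) < m := by exact_mod_cast hm
  have hxb : xbar ∈ X := by
    have := hXconvex.sum_mem (t := Finset.univ) (w := fun _ : Fin m => (m : ℝ)⁻¹) (z := xs)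
      (fun _ _ => by positivity) (by simp [hm0.ne']) (fun i _ => hxs i)
    rw [hxbar, Finset.smul_sum]
    exact this
  have hJs : ∀ x, J x = F x (ystar x) := fun x =>
    (hJ x).unique ⟨⟨_, hystar_mem x, rfl⟩, by rintro _ ⟨y, hy, rfl⟩; exact hystar_max x hy⟩
  have hgx : ∀ y x x', ‖gradient (fun u => F u y) x - gradient (fun u => F u y) x'‖
      ≤ Lf * ‖x - x'‖ := by
    intro y x x'
    have := hlip x x' y y
    refine le_of_sq_le_sq ?_ (by positivity)
    rw [mul_pow]
    simp only [sub_self, norm_zero] at this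
    nlinarith [sq_nonneg ‖gradient (fun v => F x v) y - gradient (fun v => F x' v) y‖]
  have hgy : ∀ x y y', ‖gradient (fun u => F u y) x - gradient (fun u => F u y') x‖ ^ 2
      ≤ Lf ^ 2 * ‖y - y'‖ ^ 2 := by
    intro x y y'
    have := hlip x x y y'
    simp only [sub_self, norm_zero] at this
    nlinarith [sq_nonneg ‖gradient (fun v => F x v) y - gradient (fun v => F x v) y'‖]
  set G := gradient (fun u => F u (ystar xbar)) xbar with hG
  -- descent for J
  have hJd : ∀ d, J (xbar + d) - J xbar ≤ ⟪G, d⟫ + (Lf + Lf ^ 2 / μ) / 2 * ‖d‖ ^ 2 := by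
    intro d
    rw [hJs, hJs]
    set yp := ystar (xbar + d)
    have h1 := aux_descent _ Lf (hdiffx yp) (hgx yp) xbar d
    have h2 := aux_conc (F xbar) μ _ (hconc xbar) Y hYconvex _ yp (hystar_mem xbar)
      (hystar_mem _) (hystar_max xbar)
    have h3 := aux_young_s7 (gradient (fun u => F u yp) xbar - G) d (Lf ^ 2 / μ) (by positivity)
    rw [inner_sub_left] at h3
    have h4 := mul_le_mul_of_nonneg_left (hgy xbar yp (ystar xbar))
      (show 0 ≤ 1 / (2 * (Lf ^ 2 / μ)) by positivity)
    have h5 : 1 / (2 * (Lf ^ 2 / μ)) * (Lf ^ 2 * ‖yp - ystar xbar‖ ^ 2)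
      = μ / 2 * ‖yp - ystar xbar‖ ^ 2 := by field_simp
    rw [h5] at h4
    nlinarith
  set a : EuclideanSpace ℝ (Fin p1) := (m : ℝ)⁻¹ • ∑ i, (xt i - xbar) with ha
  have hxa : (m : ℝ)⁻¹ • ∑ i, xt i = xbar + a := by
    rw [ha, Finset.sum_sub_distrib, smul_sub]
    simp only [Finset.sum_const, Finset.card_univ, Fintype.card_fin, ← Nat.cast_smul_eq_nsmul ℝ]
    rw [inv_smul_smul₀ hm0.ne']
    abel
  have hxp : xbarplus = xbar + ν • a := by rw [hxbarplus, hxa]; congr 2; abel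
  have hna : ‖a‖ ^ 2 ≤ (m : ℝ)⁻¹ * ∑ i, ‖xt i - xbar‖ ^ 2 := by
    have hc : ConvexOn ℝ Set.univ (fun x : EuclideanSpace ℝ (Fin p1) => ‖x‖ ^ 2) :=
      (convexOn_univ_norm).pow (fun _ _ => norm_nonneg _) 2
    exact aux_jensen hm _ hc (fun i => xt i - xbar)
  have hJ1 := hJd (ν • a)
  rw [inner_smul_right, norm_smul, mul_pow, Real.norm_eq_abs, sq_abs] at hJ1
  have hh1 : h (xbar + ν • a) ≤ h xbar + ν * ((m : ℝ)⁻¹ * ∑ i, (h (xt i) - h xbar)) := by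
    have h1 := hconv.2 (Set.mem_univ xbar) (Set.mem_univ (xbar + a)) (sub_nonneg.2 hν1) hν.le
      (by ring)
    rw [show (1 - ν) • xbar + ν • (xbar + a) = xbar + ν • a by module] at h1
    simp only [smul_eq_mul] at h1
    have h2 := aux_jensen hm h hconv xt
    rw [hxa] at h2
    have h3 : (m : ℝ)⁻¹ * ∑ i, (h (xt i) - h xbar) = (m : ℝ)⁻¹ * ∑ i, h (xt i) - h xbar := by
      rw [Finset.sum_sub_distrib]
      simp only [Finset.sum_const, Finset.card_univ, Fintype.card_fin, nsmul_eq_mul]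
      field_simp
    rw [h3]
    nlinarith
  have hGa : ⟪G, a⟫ = (m : ℝ)⁻¹ * ∑ i, ⟪G, xt i - xbar⟫ := by
    rw [ha, inner_smul_right, inner_sum]
  have hi : ∀ i, ⟪G, xt i - xbar⟫ + (h (xt i) - h xbar) ≤
      Lf ^ 2 / (2 * β) * ‖ystar xbar - ybar‖ ^ 2
      + 1 / (2 * β) * ‖gradient (fun u => F u ybar) xbar - ps i‖ ^ 2
      + τ / (2 * β) * ‖xs i - xbar‖ ^ 2
      - (τ - β - τ * β / 2) * ‖xt i - xbar‖ ^ 2 := by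
    intro i
    have h1 := aux_prox h hconv X hXconvex τ (ps i) (xs i) (xt i) xbar (hxt_mem i) hxb (hxt_min i)
    have h2 := mul_le_mul_of_nonneg_left (aux_young_s7 (xs i - xbar) (xt i - xbar) β hβ) hτ.le
    have h3 := aux_young_s7 (G - gradient (fun u => F u ybar) xbar) (xt i - xbar) β hβ
    have h4 := aux_young_s7 (gradient (fun u => F u ybar) xbar - ps i) (xt i - xbar) β hβ
    have h5 := mul_le_mul_of_nonneg_left (hgy xbar (ystar xbar) ybar)
      (show 0 ≤ 1 / (2 * β) by positivity)
    rw [inner_sub_left] at h3 h4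
    have e1 : Lf ^ 2 / (2 * β) * ‖ystar xbar - ybar‖ ^ 2
      = 1 / (2 * β) * (Lf ^ 2 * ‖ystar xbar - ybar‖ ^ 2) := by ring
    have e2 : τ / (2 * β) * ‖xs i - xbar‖ ^ 2 = τ * (1 / (2 * β) * ‖xs i - xbar‖ ^ 2) := by ring
    rw [e1, e2]
    linarith
  have hsum := Finset.sum_le_sum (fun i (_ : i ∈ Finset.univ) => hi i)
  simp only [Finset.sum_add_distrib, Finset.sum_sub_distrib, ← Finset.mul_sum, Finset.sum_const,
    Finset.card_univ, Fintype.card_fin, nsmul_eq_mul] at hsum hh1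
  have hsum2 := mul_le_mul_of_nonneg_left hsum (show 0 ≤ ν * (m : ℝ)⁻¹ by positivity)
  have hna2 := mul_le_mul_of_nonneg_left hna
    (show 0 ≤ (Lf + Lf ^ 2 / μ) / 2 * ν ^ 2 by positivity)
  rw [hQ, hQ, hxp]
  rw [hGa] at hJ1
  generalize ∑ i, ‖xt i - xbar‖ ^ 2 = S at *
  generalize ∑ i, ‖xs i - xbar‖ ^ 2 = S1 at *
  generalize ∑ i, ‖gradient (fun u => F u ybar) xbar - ps i‖ ^ 2 = S2 at *
  generalize ‖ystar xbar - ybar‖ ^ 2 = S3 at *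
  have key : ν * Lf ^ 2 / (2 * β) * S3 + ν / (2 * β * m) * S2 + ν * τ / (2 * β * m) * S1
      - (ν * τ / m - ν ^ 2 * (Lf + Lf ^ 2 / μ) / (2 * m) - ν * β / m
          - ν * τ * β / (2 * m)) * S
      = ν * (m : ℝ)⁻¹ * (m * (Lf ^ 2 / (2 * β) * S3) + 1 / (2 * β) * S2 + τ / (2 * β) * S1
        - (τ - β - τ * β / 2) * S) + (Lf + Lf ^ 2 / μ) / 2 * ν ^ 2 * ((m : ℝ)⁻¹ * S) := by
    field_simp
    ring
  rw [key]
  linarith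
end

section
/- Let W be a real m×m symmetric matrix whose rows each sum to one, and let λ ≥ 0 be such that ‖W v‖ ≤ λ‖v‖ for every v ∈ ℝ^m with Σᵢ vᵢ = 0. Let z₁,…,z_m, u₁,…,u_m ∈ ℝ^d, let s ∈ ℝ, and define the consensus update zᵢ⁺ := Σⱼ W_{ij} zⱼ + s(uᵢ − zᵢ) for each i. With z̄ := (1/m)Σᵢ zᵢ and z̄⁺ := (1/m)Σᵢ zᵢ⁺, for every constant c > 0: Σᵢ‖zᵢ⁺ − z̄⁺‖² ≤ (1 + c)λ² Σᵢ‖zᵢ − z̄‖² + (1 + 1/c)s² Σᵢ‖uᵢ − zᵢ‖². -/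
/-- Consensus-error contraction of the mixing-plus-correction update
`zᵢ⁺ = Σⱼ W_{ij} zⱼ + s(uᵢ − zᵢ)`. -/
theorem stmt_9
    (m d : ℕ) (hm : 0 < m)
    (W : Matrix (Fin m) (Fin m) ℝ)
    (hWsymm : W.IsSymm)
    (hWrow : ∀ i, ∑ j, W i j = 1)
    (lam : ℝ) (hlam : 0 ≤ lam)
    -- `‖W v‖ ≤ λ ‖v‖` for every `v` with zero coordinate sum (Euclidean norms)
    (hW_contract : ∀ v : EuclideanSpace ℝ (Fin m), (∑ i, v i) = 0 →
      ‖Matrix.toEuclideanLin W v‖ ≤ lam * ‖v‖)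
    (z u : Fin m → EuclideanSpace ℝ (Fin d))
    (s : ℝ)
    (zplus : Fin m → EuclideanSpace ℝ (Fin d))
    (hzplus : ∀ i, zplus i = (∑ j, W i j • z j) + s • (u i - z i))
    (zbar : EuclideanSpace ℝ (Fin d)) (hzbar : zbar = (m : ℝ)⁻¹ • ∑ i, z i)
    (zbarplus : EuclideanSpace ℝ (Fin d))
    (hzbarplus : zbarplus = (m : ℝ)⁻¹ • ∑ i, zplus i) :
    ∀ c : ℝ, 0 < c →
      ∑ i, ‖zplus i - zbarplus‖ ^ 2 ≤
        (1 + c) * lam ^ 2 * ∑ i, ‖z i - zbar‖ ^ 2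
        + (1 + 1 / c) * s ^ 2 * ∑ i, ‖u i - z i‖ ^ 2 := by
  intro c hc
  have hm' : (m : ℝ) ≠ 0 := by positivity
  have h1 : ∑ i, ‖zplus i - zbarplus‖ ^ 2 ≤ ∑ i, ‖zplus i - zbar‖ ^ 2 := by
    have hz : ∑ i, (zplus i - zbarplus) = 0 := by
      rw [Finset.sum_sub_distrib, hzbarplus]
      simp only [Finset.sum_const, Finset.card_univ, Fintype.card_fin]
      rw [← Nat.cast_smul_eq_nsmul ℝ, smul_smul, mul_inv_cancel₀ hm', one_smul, sub_self]
    have hi : ∑ i, inner ℝ (zplus i - zbarplus) (zbarplus - zbar) = 0 := by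
      rw [← sum_inner, hz, inner_zero_left]
    have he : ∀ i, ‖zplus i - zbarplus‖ ^ 2
        + 2 * inner ℝ (zplus i - zbarplus) (zbarplus - zbar) ≤ ‖zplus i - zbar‖ ^ 2 := by
      intro i
      have h : zplus i - zbar = (zplus i - zbarplus) + (zbarplus - zbar) := by abel
      rw [h, norm_add_sq_real]
      nlinarith [sq_nonneg ‖zbarplus - zbar‖]
    have := Finset.sum_le_sum (s := Finset.univ) (fun i _ => he i)
    rw [Finset.sum_add_distrib, ← Finset.mul_sum, hi] at this
    linarith
  have hy : ∑ i, (z i - zbar) = 0 := by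
    rw [Finset.sum_sub_distrib, hzbar]
    simp only [Finset.sum_const, Finset.card_univ, Fintype.card_fin]
    rw [← Nat.cast_smul_eq_nsmul ℝ, smul_smul, mul_inv_cancel₀ hm', one_smul, sub_self]
  have hd : ∀ i, zplus i - zbar = (∑ j, W i j • (z j - zbar)) + s • (u i - z i) := by
    intro i
    rw [hzplus]
    simp only [smul_sub, Finset.sum_sub_distrib]
    rw [← Finset.sum_smul, hWrow, one_smul]
    abel
  have h2 : ∑ i, ‖∑ j, W i j • (z j - zbar)‖ ^ 2 ≤ lam ^ 2 * ∑ i, ‖z i - zbar‖ ^ 2 := by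
    simp only [EuclideanSpace.real_norm_sq_eq]
    rw [Finset.sum_comm, Finset.sum_comm (f := fun i k => ((z i - zbar) k) ^ 2), Finset.mul_sum]
    apply Finset.sum_le_sum
    intro k _
    have hk : ∑ i, (z i - zbar) k = 0 := by
      have := congrArg (fun v : EuclideanSpace ℝ (Fin d) => v k) hy
      simpa using this
    have h := hW_contract (WithLp.toLp 2 (fun i => (z i - zbar) k)) hk
    have h' := pow_le_pow_left₀ (norm_nonneg _) h 2
    rw [mul_pow, EuclideanSpace.real_norm_sq_eq, EuclideanSpace.real_norm_sq_eq] at h'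
    simpa [Matrix.mulVec, dotProduct] using h'
  have hyoung : ∀ a b : EuclideanSpace ℝ (Fin d),
      ‖a + b‖ ^ 2 ≤ (1 + c) * ‖a‖ ^ 2 + (1 + 1 / c) * ‖b‖ ^ 2 := by
    intro a b
    have h := pow_le_pow_left₀ (norm_nonneg _) (norm_add_le a b) 2
    have : (1 + c) * ‖a‖ ^ 2 + (1 + 1 / c) * ‖b‖ ^ 2 - (‖a‖ + ‖b‖) ^ 2
        = (c * ‖a‖ - ‖b‖) ^ 2 / c := by
      field_simp
      ring
    have h3 : 0 ≤ (c * ‖a‖ - ‖b‖) ^ 2 / c := by positivity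
    linarith
  calc _ ≤ _ := h1
    _ ≤ ∑ i, ((1 + c) * ‖∑ j, W i j • (z j - zbar)‖ ^ 2
          + (1 + 1 / c) * (s ^ 2 * ‖u i - z i‖ ^ 2)) := by
        apply Finset.sum_le_sum
        intro i _
        rw [hd]
        refine (hyoung _ _).trans (le_of_eq ?_)
        rw [norm_smul, mul_pow, Real.norm_eq_abs, sq_abs]
    _ = (1 + c) * ∑ i, ‖∑ j, W i j • (z j - zbar)‖ ^ 2
          + (1 + 1 / c) * s ^ 2 * ∑ i, ‖u i - z i‖ ^ 2 := by
        rw [Finset.sum_add_distrib, ← Finset.mul_sum, ← Finset.mul_sum, ← Finset.mul_sum]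
        ring
    _ ≤ _ := by
        have := mul_le_mul_of_nonneg_left h2 (by positivity : 0 ≤ 1 + c)
        linarith
end

section
/- Let f₁,…,f_n : ℝ^{p1} × ℝ^{p2} → ℝ be differentiable, each with L-Lipschitz gradient (‖∇fⱼ(x,y) − ∇fⱼ(x′,y′)‖² ≤ L²(‖x − x′‖² + ‖y − y′‖²) for all arguments), and let F := (1/n)Σⱼ fⱼ. Fix points (x,y) and (x′,y′), let 1 ≤ q ≤ n, and let S be a uniformly random q-element subset of {1,…,n}. Then the variance-reduced mini-batch correction term satisfies E‖(1/q)Σ_{j∈S}(∇_x fⱼ(x,y) − ∇_x fⱼ(x′,y′)) − (∇_x F(x,y) − ∇_x F(x′,y′))‖² ≤ (L²/q)(‖x − x′‖² + ‖y − y′‖²). -/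
theorem aux_pair (n q : ℕ) : ∃ B : ℕ, ∀ i j : Fin n, i ≠ j →
    ((Finset.powersetCard q (Finset.univ : Finset (Fin n))).filter
      (fun S => i ∈ S ∧ j ∈ S)).card = B := by
  by_cases h : 2 ≤ q
  · refine ⟨(n - 2).choose (q - 2), fun i j hij => ?_⟩
    have h1 := Finset.card_filter_powersetCard_subset ({i, j} : Finset (Fin n)) Finset.univ q
      (by simp) (by rw [Finset.card_pair hij]; exact h)
    rw [Finset.card_pair hij, Finset.card_univ, Fintype.card_fin] at h1
    rw [← h1]
    congr 1
    ext S
    simp [Finset.insert_subset_iff]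
  · refine ⟨0, fun i j hij => ?_⟩
    rw [Finset.card_eq_zero, Finset.filter_eq_empty_iff]
    rintro S hS ⟨hi, hj⟩
    rw [Finset.mem_powersetCard_univ] at hS
    have := Finset.one_lt_card.2 ⟨i, hi, j, hj, hij⟩
    omega

theorem aux_single (n q : ℕ) (hq : 1 ≤ q) (i : Fin n) :
    ((Finset.powersetCard q (Finset.univ : Finset (Fin n))).filter
      (fun S => i ∈ S ∧ i ∈ S)).card = (n - 1).choose (q - 1) := by
  have h1 := Finset.card_filter_powersetCard_subset ({i} : Finset (Fin n)) Finset.univ q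
      (by simp) (by simpa using hq)
  rw [Finset.card_singleton, Finset.card_univ, Fintype.card_fin] at h1
  rw [← h1]
  congr 1
  ext S
  simp

theorem aux_sum {E : Type*} [NormedAddCommGroup E] [InnerProductSpace ℝ E]
    (n q : ℕ) (hq : 1 ≤ q) (z : Fin n → E) (hz : ∑ j, z j = 0) :
    ∑ S ∈ Finset.powersetCard q (Finset.univ : Finset (Fin n)), ‖∑ j ∈ S, z j‖ ^ 2
      ≤ ((n - 1).choose (q - 1) : ℝ) * ∑ j, ‖z j‖ ^ 2 := by
  obtain ⟨B, hB⟩ := aux_pair n q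
  set A := (n - 1).choose (q - 1) with hA
  have e1 : ∀ S : Finset (Fin n), ‖∑ j ∈ S, z j‖ ^ 2 =
      ∑ i, ∑ j, if i ∈ S ∧ j ∈ S then inner ℝ (z i) (z j) else 0 := by
    intro S
    rw [← real_inner_self_eq_norm_sq, sum_inner]
    rw [← Finset.sum_filter_add_sum_filter_not Finset.univ (fun i => i ∈ S)]
    rw [Finset.sum_eq_zero (s := Finset.univ.filter (fun i => ¬ i ∈ S))]
    · simp only [Finset.filter_mem_eq_inter, Finset.univ_inter, add_zero]
      refine Finset.sum_congr rfl fun i hi => ?_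
      rw [inner_sum]
      simp [hi, Finset.sum_ite_mem]
    · intro i hi
      simp at hi
      simp [hi]
  have e2 : ∑ S ∈ Finset.powersetCard q (Finset.univ : Finset (Fin n)), ‖∑ j ∈ S, z j‖ ^ 2
      = ∑ i, ∑ j, (((Finset.powersetCard q (Finset.univ : Finset (Fin n))).filter
          (fun S => i ∈ S ∧ j ∈ S)).card : ℝ) * inner ℝ (z i) (z j) := by
    simp_rw [e1]
    rw [Finset.sum_comm]
    refine Finset.sum_congr rfl fun i _ => ?_
    rw [Finset.sum_comm]
    refine Finset.sum_congr rfl fun j _ => ?_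
    rw [← Finset.sum_filter, Finset.sum_const, nsmul_eq_mul]
  have e3 : ∀ i j : Fin n, (((Finset.powersetCard q (Finset.univ : Finset (Fin n))).filter
          (fun S => i ∈ S ∧ j ∈ S)).card : ℝ) * inner ℝ (z i) (z j)
      = (B : ℝ) * inner ℝ (z i) (z j) +
        (if i = j then ((A : ℝ) - B) * inner ℝ (z i) (z j) else 0) := by
    intro i j
    by_cases h : i = j
    · subst h
      rw [aux_single n q hq]
      simp only [if_true]
      ring
    · rw [hB i j h]
      simp [h]
  rw [e2]
  simp_rw [e3, Finset.sum_add_distrib, ← Finset.mul_sum, ← inner_sum, hz]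
  simp only [inner_zero_right, Finset.sum_const_zero, mul_zero, zero_add, Finset.sum_ite_eq,
    Finset.mem_univ, if_true, real_inner_self_eq_norm_sq]
  rw [← Finset.mul_sum]
  have h1 : 0 ≤ ∑ j, ‖z j‖ ^ 2 := Finset.sum_nonneg fun _ _ => sq_nonneg _
  have h2 : (0 : ℝ) ≤ B := Nat.cast_nonneg _
  nlinarith [mul_nonneg h2 h1]

theorem aux_main {E : Type*} [NormedAddCommGroup E] [InnerProductSpace ℝ E]
    (n q : ℕ) (hq : 1 ≤ q) (hqn : q ≤ n) (d : Fin n → E) (C : ℝ) (hd : ∀ j, ‖d j‖ ^ 2 ≤ C) :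
    ((n.choose q : ℝ))⁻¹ *
      ∑ S ∈ Finset.powersetCard q (Finset.univ : Finset (Fin n)),
        ‖(q : ℝ)⁻¹ • (∑ j ∈ S, d j) - (n : ℝ)⁻¹ • ∑ j, d j‖ ^ 2 ≤ C / q := by
  have hq0 : (0 : ℝ) < q := by exact_mod_cast hq
  have hn0 : (0 : ℝ) < n := by exact_mod_cast (lt_of_lt_of_le hq hqn)
  set m : E := (n : ℝ)⁻¹ • ∑ j, d j with hm
  have hnm : ∑ j, d j = (n : ℝ) • m := by
    rw [hm, smul_smul, mul_inv_cancel₀ hn0.ne', one_smul]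
  have hz : ∑ j, (d j - m) = 0 := by
    rw [Finset.sum_sub_distrib, hnm]
    simp [Nat.cast_smul_eq_nsmul]
  have key := aux_sum n q hq (fun j => d j - m) hz
  have e1 : ∀ S ∈ Finset.powersetCard q (Finset.univ : Finset (Fin n)),
      ‖(q : ℝ)⁻¹ • (∑ j ∈ S, d j) - m‖ ^ 2 = ((q : ℝ)⁻¹) ^ 2 * ‖∑ j ∈ S, (d j - m)‖ ^ 2 := by
    intro S hS
    rw [Finset.mem_powersetCard_univ] at hS
    have : (q : ℝ)⁻¹ • (∑ j ∈ S, d j) - m = (q : ℝ)⁻¹ • ∑ j ∈ S, (d j - m) := by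
      rw [Finset.sum_sub_distrib, Finset.sum_const, hS, smul_sub, ← Nat.cast_smul_eq_nsmul ℝ,
        smul_smul, inv_mul_cancel₀ hq0.ne', one_smul]
    rw [this, norm_smul, mul_pow, Real.norm_eq_abs, sq_abs]
  rw [Finset.sum_congr rfl e1, ← Finset.mul_sum]
  have hvar : ∑ j, ‖d j - m‖ ^ 2 ≤ n * C := by
    have h1 : ∑ j, ‖d j - m‖ ^ 2 = ∑ j, ‖d j‖ ^ 2 - n * ‖m‖ ^ 2 := by
      simp_rw [norm_sub_sq_real, Finset.sum_add_distrib, Finset.sum_sub_distrib,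
        ← Finset.mul_sum, ← sum_inner, hnm, real_inner_smul_left, real_inner_self_eq_norm_sq]
      simp
      ring
    have h2 : ∑ j, ‖d j‖ ^ 2 ≤ n * C := by
      have := Finset.sum_le_sum (s := Finset.univ) fun j _ => hd j
      simpa using this
    have h3 : 0 ≤ (n : ℝ) * ‖m‖ ^ 2 := by positivity
    linarith
  have hch : (n : ℝ) * ((n - 1).choose (q - 1) : ℝ) = (n.choose q : ℝ) * q := by
    obtain ⟨n', rfl⟩ : ∃ k, n = k + 1 := ⟨n - 1, by omega⟩
    obtain ⟨q', rfl⟩ : ∃ k, q = k + 1 := ⟨q - 1, by omega⟩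
    exact_mod_cast Nat.add_one_mul_choose_eq n' q'
  have hC0 : (0 : ℝ) < n.choose q := by exact_mod_cast Nat.choose_pos hqn
  have hA0 : (0 : ℝ) ≤ ((n - 1).choose (q - 1) : ℝ) := Nat.cast_nonneg _
  calc _ ≤ ((n.choose q : ℝ))⁻¹ * (((q : ℝ)⁻¹) ^ 2 *
        (((n - 1).choose (q - 1) : ℝ) * (n * C))) := by
        gcongr
        exact key.trans (by gcongr)
    _ = ((n.choose q : ℝ))⁻¹ * (((q : ℝ)⁻¹) ^ 2 *
        ((n * ((n - 1).choose (q - 1) : ℝ)) * C)) := by ring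
    _ = C / q := by
        rw [hch]
        field_simp

theorem aux_grad {E : Type*} [NormedAddCommGroup E] [InnerProductSpace ℝ E] [CompleteSpace E]
    (n : ℕ) (c : ℝ) (g : Fin n → E → ℝ) (hg : ∀ j, Differentiable ℝ (g j)) (G : E → ℝ)
    (hG : ∀ u, G u = c * ∑ j, g j u) (x : E) :
    gradient G x = c • ∑ j, gradient (g j) x := by
  apply HasGradientAt.gradient
  rw [hasGradientAt_iff_hasFDerivAt]
  have h := (HasFDerivAt.fun_sum (u := Finset.univ)
    fun j _ => (hg j x).hasGradientAt.hasFDerivAt).const_mul c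
  rw [show G = fun u => c * ∑ j, g j u from funext hG]
  have e : (InnerProductSpace.toDual ℝ E) (c • ∑ j, gradient (g j) x) =
      c • ∑ i, (InnerProductSpace.toDual ℝ E) (gradient (g i) x) := by
    rw [← map_sum]
    ext v
    simp only [InnerProductSpace.toDual_apply_apply, real_inner_smul_left,
      ContinuousLinearMap.smul_apply, smul_eq_mul]
  rw [e]
  exact h

/-- Second-moment bound for the variance-reduced mini-batch gradient correction:
with `S` a uniformly random `q`-element subset of `{1,…,n}` (expectation = average
over all such subsets),
`E‖(1/q)Σ_{j∈S}(∇_x fⱼ(x,y) − ∇_x fⱼ(x′,y′)) − (∇_x F(x,y) − ∇_x F(x′,y′))‖²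
  ≤ (L²/q)(‖x − x′‖² + ‖y − y′‖²)`. -/
theorem stmt_13
    (p1 p2 n q : ℕ) (hq : 1 ≤ q) (hqn : q ≤ n)
    (L : ℝ) (hL : 0 < L)
    (f : Fin n → EuclideanSpace ℝ (Fin p1) → EuclideanSpace ℝ (Fin p2) → ℝ)
    (hdiffx : ∀ j y, Differentiable ℝ (fun x => f j x y))
    (hdiffy : ∀ j x, Differentiable ℝ (fun y => f j x y))
    -- each `fⱼ` has `L`-Lipschitz (joint) gradient
    (hlip : ∀ j x x' y y',
      ‖gradient (fun u => f j u y) x - gradient (fun u => f j u y') x'‖ ^ 2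
        + ‖gradient (fun v => f j x v) y - gradient (fun v => f j x' v) y'‖ ^ 2
      ≤ L ^ 2 * (‖x - x'‖ ^ 2 + ‖y - y'‖ ^ 2))
    -- `F = (1/n) Σⱼ fⱼ`
    (F : EuclideanSpace ℝ (Fin p1) → EuclideanSpace ℝ (Fin p2) → ℝ)
    (hF : ∀ u v, F u v = (n : ℝ)⁻¹ * ∑ j, f j u v)
    (x x' : EuclideanSpace ℝ (Fin p1)) (y y' : EuclideanSpace ℝ (Fin p2)) :
    ((n.choose q : ℝ))⁻¹ *
      ∑ S ∈ Finset.powersetCard q (Finset.univ : Finset (Fin n)),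
        ‖(q : ℝ)⁻¹ • (∑ j ∈ S,
            (gradient (fun u => f j u y) x - gradient (fun u => f j u y') x'))
          - (gradient (fun u => F u y) x - gradient (fun u => F u y') x')‖ ^ 2
    ≤ L ^ 2 / q * (‖x - x'‖ ^ 2 + ‖y - y'‖ ^ 2) := by
  have hgr : gradient (fun u => F u y) x - gradient (fun u => F u y') x' = (n : ℝ)⁻¹ • ∑ j,
      (gradient (fun u => f j u y) x - gradient (fun u => f j u y') x') := by
    rw [aux_grad n (n : ℝ)⁻¹ (fun j u => f j u y) (fun j => hdiffx j y) _ (fun u => hF u y) x,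
      aux_grad n (n : ℝ)⁻¹ (fun j u => f j u y') (fun j => hdiffx j y') _ (fun u => hF u y') x',
      ← smul_sub, ← Finset.sum_sub_distrib]
  rw [hgr]
  have h := aux_main n q hq hqn
    (fun j => gradient (fun u => f j u y) x - gradient (fun u => f j u y') x')
    (L ^ 2 * (‖x - x'‖ ^ 2 + ‖y - y'‖ ^ 2))
    (fun j => le_trans (le_add_of_nonneg_right (sq_nonneg _)) (hlip j x x' y y'))
  refine h.trans (le_of_eq ?_)
  ring
end
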